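/- Let m > 0 and α ∈ ℝ with α ≠ 0, and define q : (−m, m) → ℝ by q(ω) = −4ω√(m²−ω²) + 2αω² − α(m²−ω²) + (α³/4)ω². Set κ = (α³/2 + 6α)/4, κ̂ = |κ|/√(4+κ²), a = (m/√2)√(1−κ̂) and b = (m/√2)√(1+κ̂). If α > 0 then for ω ∈ (−m, m): q'(ω) < 0 if and only if −b < ω < a, and q'(ω) > 0 if and only if ω ∈ (−m, −b) ∪ (a, m). If α < 0 then for ω ∈ (−m, m): q'(ω) < 0 if and only if −a < ω < b, and q'(ω) > 0 if and only if ω ∈ (−m, −a) ∪ (b, m). -/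

import Mathlib

open Filter Set Topology

/-- On the right half-circle, the point with the smaller first coordinate has the smaller slope. -/
lemma mul_lt_mul_of_lt_of_sq_add_sq_eq {x s c d : ℝ} (hs : 0 < s) (hd : 0 < d)
    (h : x ^ 2 + s ^ 2 = c ^ 2 + d ^ 2) (hxc : x < c) : d * x < c * s := by
  rcases le_or_gt 0 x with hx | hx
  · have hds : d < s := by
      apply lt_of_pow_lt_pow_left₀ 2 hs.le
      nlinarith
    nlinarith
  · rcases le_or_gt 0 c with hc | hc
    · nlinarith [mul_nonneg hc hs.le, mul_pos hd (neg_pos.2 hx)]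
    · have hsd : s < d := by
        apply lt_of_pow_lt_pow_left₀ 2 hd.le
        nlinarith
      nlinarith

lemma mul_lt_mul_iff_of_sq_add_sq_eq {x s c d : ℝ} (hs : 0 < s) (hd : 0 < d)
    (h : x ^ 2 + s ^ 2 = c ^ 2 + d ^ 2) : d * x < c * s ↔ x < c := by
  refine ⟨fun hlt => ?_, mul_lt_mul_of_lt_of_sq_add_sq_eq hs hd h⟩
  by_contra! hcx
  rcases hcx.lt_or_eq with hcx | rfl
  · have := mul_lt_mul_of_lt_of_sq_add_sq_eq hd hs h.symm hcx
    linarith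
  · have hsd : s = d := by
      rw [← pow_left_inj₀ hs.le hd.le two_ne_zero]
      linarith
    subst hsd
    linarith

/-- The sign of the quadratic form `x² + κxs - s²` on the right half-circle through `(a, b)` and
`(-b, a)`, where it vanishes. -/
lemma quadratic_neg_and_pos_iff {x s a b κ : ℝ} (hs : 0 < s) (ha : 0 < a) (hb : 0 < b)
    (h : x ^ 2 + s ^ 2 = a ^ 2 + b ^ 2) (hκ : κ * (a * b) = b ^ 2 - a ^ 2) :
    (x ^ 2 - s ^ 2 + κ * x * s < 0 ↔ -b < x ∧ x < a) ∧
      (0 < x ^ 2 - s ^ 2 + κ * x * s ↔ x < -b ∨ a < x) := by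
  have hab : 0 < a * b := mul_pos ha hb
  have hfac : (x ^ 2 - s ^ 2 + κ * x * s) * (a * b) = (b * x - a * s) * (a * x + b * s) := by
    linear_combination x * s * hκ
  have h₁ : b * x < a * s ↔ x < a := mul_lt_mul_iff_of_sq_add_sq_eq hs hb h
  have h₂ : a * s < b * x ↔ a < x := by
    simpa only [mul_comm] using mul_lt_mul_iff_of_sq_add_sq_eq hb hs h.symm
  have h' : x ^ 2 + s ^ 2 = (-b) ^ 2 + a ^ 2 := by linarith
  have h₃ : a * x < -b * s ↔ x < -b := mul_lt_mul_iff_of_sq_add_sq_eq hs ha h'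
  have h₄ : -b * s < a * x ↔ -b < x := by
    simpa only [mul_comm] using mul_lt_mul_iff_of_sq_add_sq_eq ha hs h'.symm
  constructor
  · rw [← smul_neg_iff_of_pos_left hab, smul_eq_mul, mul_comm (a * b), hfac, mul_neg_iff, ← h₁, ← h₄]
    constructor
    · rintro (⟨hp, hn⟩ | ⟨hn, hp⟩)
      · have := h₂.1 (by linarith)
        have := h₃.1 (by linarith)
        linarith
      · constructor <;> linarith
    · rintro ⟨hp, hn⟩
      right
      constructor <;> linarith
  · rw [← mul_pos_iff_of_pos_right hab, hfac, mul_pos_iff]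
    constructor
    · rintro (⟨hp, hn⟩ | ⟨hn, hp⟩)
      · exact Or.inr (h₂.1 (by linarith))
      · exact Or.inl (h₃.1 (by linarith))
    · rintro (hx | hx)
      · right
        have := h₁.2 (by linarith)
        have := h₃.2 hx
        constructor <;> linarith
      · left
        have := h₂.2 hx
        have := h₄.2 (by linarith)
        constructor <;> linarith

lemma abs_div_sqrt_four_add_sq_lt_one (κ : ℝ) : |κ| / √(4 + κ ^ 2) < 1 := by
  rw [div_lt_one (by positivity)]
  apply Real.lt_sqrt_of_sq_lt
  rw [sq_abs]
  linarith

lemma abs_mul_half_angle_eq {m κ : ℝ} :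
    let k : ℝ := |κ| / √(4 + κ ^ 2)
    let a : ℝ := m / √2 * √(1 - k)
    let b : ℝ := m / √2 * √(1 + k)
    a ^ 2 + b ^ 2 = m ^ 2 ∧ |κ| * (a * b) = b ^ 2 - a ^ 2 := by
  intro k a b
  have hk₀ : 0 ≤ k := by positivity
  have hk₁ : k < 1 := abs_div_sqrt_four_add_sq_lt_one κ
  have ha : a ^ 2 = m ^ 2 / 2 * (1 - k) := by
    simp only [a]
    rw [mul_pow, div_pow, Real.sq_sqrt zero_le_two, Real.sq_sqrt (by linarith)]
  have hb : b ^ 2 = m ^ 2 / 2 * (1 + k) := by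
    simp only [b]
    rw [mul_pow, div_pow, Real.sq_sqrt zero_le_two, Real.sq_sqrt (by linarith)]
  have hR : 0 < √(4 + κ ^ 2) := by positivity
  have hR2 : √(4 + κ ^ 2) ^ 2 = 4 + κ ^ 2 := Real.sq_sqrt (by positivity)
  have hprod : √(1 - k) * √(1 + k) = 2 / √(4 + κ ^ 2) := by
    rw [← Real.sqrt_mul (by linarith), Real.sqrt_eq_iff_mul_self_eq (by nlinarith) (by positivity)]
    simp only [k]
    field_simp
    linear_combination hR2 - sq_abs κ
  have hab : a * b = m ^ 2 / √(4 + κ ^ 2) := by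
    calc a * b = m ^ 2 / √2 ^ 2 * (√(1 - k) * √(1 + k)) := by simp only [a, b]; ring
      _ = m ^ 2 / √(4 + κ ^ 2) := by
        rw [hprod, Real.sq_sqrt zero_le_two]
        ring
  refine ⟨by rw [ha, hb]; ring, ?_⟩
  rw [ha, hb, hab]
  simp only [k]
  ring

lemma hasDerivAt_charge {m α ω : ℝ} (hω : 0 < m ^ 2 - ω ^ 2) :
    HasDerivAt (fun w : ℝ => -4 * w * √(m ^ 2 - w ^ 2) + 2 * α * w ^ 2 - α * (m ^ 2 - w ^ 2) +
        α ^ 3 / 4 * w ^ 2)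
      (4 / √(m ^ 2 - ω ^ 2) * (ω ^ 2 - √(m ^ 2 - ω ^ 2) ^ 2 +
        (α ^ 3 / 2 + 6 * α) / 4 * ω * √(m ^ 2 - ω ^ 2))) ω := by
  have hsq : HasDerivAt (fun w : ℝ => w ^ 2) (2 * ω) ω := by
    simpa using hasDerivAt_pow 2 ω
  have hin := hsq.const_sub (m ^ 2)
  have hlin : HasDerivAt (fun w : ℝ => -4 * w) (-4) ω := by
    simpa using (hasDerivAt_id ω).const_mul (-4 : ℝ)
  have hs : 0 < √(m ^ 2 - ω ^ 2) := Real.sqrt_pos.2 hω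
  refine ((((hlin.mul (hin.sqrt hω.ne')).add (hsq.const_mul (2 * α))).sub
    (hin.const_mul α)).add (hsq.const_mul (α ^ 3 / 4))).congr_deriv ?_
  field_simp
  ring

lemma HasDerivAt.exists_and_iff {f : ℝ → ℝ} {f' x : ℝ} (h : HasDerivAt f f' x) (P : ℝ → Prop) :
    (∃ d, HasDerivAt f d x ∧ P d) ↔ P f' :=
  ⟨fun ⟨_, hd, hP⟩ => hd.unique h ▸ hP, fun hP => ⟨f', h, hP⟩⟩

theorem stmt_18 (m α : ℝ) (hm : 0 < m) (hα : α ≠ 0) :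
    let q : ℝ → ℝ := fun w =>
      -4 * w * Real.sqrt (m ^ 2 - w ^ 2) + 2 * α * w ^ 2 - α * (m ^ 2 - w ^ 2) +
        α ^ 3 / 4 * w ^ 2
    let κ : ℝ := (α ^ 3 / 2 + 6 * α) / 4
    let κh : ℝ := |κ| / Real.sqrt (4 + κ ^ 2)
    let a : ℝ := m / Real.sqrt 2 * Real.sqrt (1 - κh)
    let b : ℝ := m / Real.sqrt 2 * Real.sqrt (1 + κh)
    (0 < α → ∀ ω : ℝ, -m < ω → ω < m →
      ((∃ d : ℝ, HasDerivAt q d ω ∧ d < 0) ↔ (-b < ω ∧ ω < a)) ∧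
      ((∃ d : ℝ, HasDerivAt q d ω ∧ 0 < d) ↔ (ω < -b ∨ a < ω))) ∧
    (α < 0 → ∀ ω : ℝ, -m < ω → ω < m →
      ((∃ d : ℝ, HasDerivAt q d ω ∧ d < 0) ↔ (-a < ω ∧ ω < b)) ∧
      ((∃ d : ℝ, HasDerivAt q d ω ∧ 0 < d) ↔ (ω < -a ∨ b < ω))) := by
  intro q κ κh a b
  have hκh₀ : 0 ≤ κh := by positivity
  have hκh₁ : κh < 1 := abs_div_sqrt_four_add_sq_lt_one κ
  have ha : 0 < a := mul_pos (by positivity) (Real.sqrt_pos.2 (by linarith))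
  have hb : 0 < b := mul_pos (by positivity) (Real.sqrt_pos.2 (by linarith))
  obtain ⟨hsum, hκab⟩ : a ^ 2 + b ^ 2 = m ^ 2 ∧ |κ| * (a * b) = b ^ 2 - a ^ 2 :=
    abs_mul_half_angle_eq
  have hκα : κ = α * ((α ^ 2 / 2 + 6) / 4) := by simp only [κ]; ring
  have key : ∀ c d : ℝ, 0 < c → 0 < d → c ^ 2 + d ^ 2 = m ^ 2 → κ * (c * d) = d ^ 2 - c ^ 2 →
      ∀ ω : ℝ, -m < ω → ω < m →
      ((∃ e : ℝ, HasDerivAt q e ω ∧ e < 0) ↔ (-d < ω ∧ ω < c)) ∧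
      ((∃ e : ℝ, HasDerivAt q e ω ∧ 0 < e) ↔ (ω < -d ∨ c < ω)) := by
    intro c d hc hd hcd hκcd ω hω₁ hω₂
    have hω : 0 < m ^ 2 - ω ^ 2 := by nlinarith
    have hs : 0 < √(m ^ 2 - ω ^ 2) := Real.sqrt_pos.2 hω
    have hs4 : 0 < 4 / √(m ^ 2 - ω ^ 2) := by positivity
    have hderiv : HasDerivAt q _ ω := hasDerivAt_charge hω
    rw [hderiv.exists_and_iff (· < 0), hderiv.exists_and_iff (0 < ·),
      ← smul_eq_mul, smul_neg_iff_of_pos_left hs4, smul_eq_mul, mul_pos_iff_of_pos_left hs4]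
    exact quadratic_neg_and_pos_iff hs hc hd (by rw [Real.sq_sqrt hω.le]; linarith) hκcd
  refine ⟨fun hα₀ => ?_, fun hα₀ => ?_⟩
  · have hκ : 0 < κ := hκα ▸ mul_pos hα₀ (by positivity)
    rw [abs_of_pos hκ] at hκab
    exact key a b ha hb hsum hκab
  · have hκ : κ < 0 := hκα ▸ mul_neg_of_neg_of_pos hα₀ (by positivity)
    rw [abs_of_neg hκ] at hκab
    exact key b a hb ha (by linarith) (by linarith)
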